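/- Let (u, N, p) be a classical solution of the damped Navier–Stokes–Bardina equations with initial datum u₀ and force f. Then for all t ≥ 0: ‖u(t,·)‖²_{L²} + α²‖u(t,·)‖²_{Ḣ¹} ≤ ( ‖u₀‖²_{L²} + α²‖u₀‖²_{Ḣ¹} ) e^{−βt} + (4/β²) ( ‖f‖²_{L²} + α²‖f‖²_{Ḣ¹} ). -/

import Mathlib

open MeasureTheory Set

noncomputable section

abbrev V3 : Type := Fin 3 → ℝ

def pd (j : Fin 3) (g : V3 → Fin 3 → ℝ) : V3 → Fin 3 → ℝ :=
  fun x => fderiv ℝ g x (Pi.single j 1)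

def pdS (j : Fin 3) (g : V3 → ℝ) : V3 → ℝ :=
  fun x => fderiv ℝ g x (Pi.single j 1)

def L2sq (g : V3 → Fin 3 → ℝ) : ℝ := ∫ x : V3, ∑ i, (g x i)^2
def H1sq (g : V3 → Fin 3 → ℝ) : ℝ := ∫ x : V3, ∑ i, ∑ j, (pd j g x i)^2
def H2sq (g : V3 → Fin 3 → ℝ) : ℝ := ∫ x : V3, ∑ i, ∑ j, ∑ k, (pd k (pd j g) x i)^2
def H1aSq (α : ℝ) (g : V3 → Fin 3 → ℝ) : ℝ := L2sq g + α^2 * H1sq g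

def IsSchwartz {F : Type*} [NormedAddCommGroup F] [NormedSpace ℝ F] (g : V3 → F) : Prop :=
  ContDiff ℝ (⊤ : ℕ∞) g ∧ ∀ (k n : ℕ), ∃ C : ℝ, ∀ x : V3, ‖x‖ ^ k * ‖iteratedFDeriv ℝ n g x‖ ≤ C

def IsForce (f : V3 → Fin 3 → ℝ) : Prop :=
  IsSchwartz f ∧ ∀ x, (∑ j, pd j f x j) = 0

def SchwartzLocBdd {F : Type*} [NormedAddCommGroup F] [NormedSpace ℝ F]
    (g : ℝ → V3 → F) : Prop :=
  ContDiffOn ℝ (⊤ : ℕ∞) (fun q : ℝ × V3 => g q.1 q.2) (Set.Ici (0:ℝ) ×ˢ Set.univ) ∧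
  ∀ T > (0:ℝ), ∀ (k n : ℕ), ∃ C : ℝ, ∀ t ∈ Set.Icc (0:ℝ) T, ∀ x : V3,
    ‖x‖ ^ k * ‖iteratedFDeriv ℝ n (g t) x‖ ≤ C

structure ClassicalSolution (α β ν : ℝ) (u₀ f : V3 → Fin 3 → ℝ) where
  u : ℝ → V3 → Fin 3 → ℝ
  N : ℝ → V3 → Fin 3 → ℝ
  p : ℝ → V3 → ℝ
  reg_u : SchwartzLocBdd u
  reg_N : SchwartzLocBdd N
  reg_p : SchwartzLocBdd p
  divFree : ∀ t ≥ (0:ℝ), ∀ x, (∑ j, pd j (u t) x j) = 0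
  filter : ∀ t ≥ (0:ℝ), ∀ x i, -α^2 * (∑ j, pd j (pd j (N t)) x i) + N t x i
      = ∑ j, u t x j * pd j (u t) x i
  momentum : ∀ t ≥ (0:ℝ), ∀ x i,
      derivWithin (fun s => u s x i) (Set.Ici (0:ℝ)) t + N t x i
        - ν * (∑ j, pd j (pd j (u t)) x i) + pdS i (p t) x
      = f x i - β * u t x i
  init : ∀ x, u 0 x = u₀ x


open SchwartzMap Filter Topology Bornology
open scoped LineDeriv

section EnergyForm

/-- The partial derivative `∂ⱼ` on scalar Schwartz functions. -/
def schwartzPartial (j : Fin 3) : 𝓢(V3, ℝ) →L[ℝ] 𝓢(V3, ℝ) :=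
  LineDeriv.lineDerivOpCLM ℝ 𝓢(V3, ℝ) (Pi.single j 1 : V3)

theorem schwartzPartial_apply (j : Fin 3) (φ : 𝓢(V3, ℝ)) (x : V3) :
    schwartzPartial j φ x = fderiv ℝ φ x (Pi.single j 1) := rfl

theorem schwartzPartial_comm (i j : Fin 3) (φ : 𝓢(V3, ℝ)) :
    schwartzPartial i (schwartzPartial j φ) = schwartzPartial j (schwartzPartial i φ) := by
  have key (a b : Fin 3) (x : V3) : schwartzPartial a (schwartzPartial b φ) x
      = fderiv ℝ (fderiv ℝ φ) x (Pi.single a 1) (Pi.single b 1) := by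
    have hd : DifferentiableAt ℝ (fderiv ℝ φ) x :=
      (((φ.smooth ⊤).fderiv_right (m := 1) (by norm_cast)).differentiable (by norm_num)) x
    rw [schwartzPartial_apply]
    change fderiv ℝ (fun y => fderiv ℝ φ y (Pi.single b 1)) x _ = _
    rw [fderiv_clm_apply hd (differentiableAt_const _)]
    simp
  ext x
  rw [key, key]
  exact ((φ.contDiffAt 2).isSymmSndFDerivAt (by simp)).eq _ _

/-- The `L²` inner product on scalar Schwartz functions. -/
def l2Form : 𝓢(V3, ℝ) →ₗ[ℝ] 𝓢(V3, ℝ) →ₗ[ℝ] ℝ :=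
  LinearMap.mk₂ ℝ (fun φ ψ => ∫ x, SchwartzMap.pairing (ContinuousLinearMap.mul ℝ ℝ) φ ψ x)
    (fun φ₁ φ₂ ψ => by
      simpa [add_mul] using integral_add (μ := volume)
        (SchwartzMap.pairing (ContinuousLinearMap.mul ℝ ℝ) φ₁ ψ).integrable
        (SchwartzMap.pairing (ContinuousLinearMap.mul ℝ ℝ) φ₂ ψ).integrable)
    (fun c φ ψ => by simp [integral_const_mul])
    (fun φ ψ₁ ψ₂ => by
      simpa [mul_add] using integral_add (μ := volume)
        (SchwartzMap.pairing (ContinuousLinearMap.mul ℝ ℝ) φ ψ₁).integrable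
        (SchwartzMap.pairing (ContinuousLinearMap.mul ℝ ℝ) φ ψ₂).integrable)
    (fun c φ ψ => by simp [integral_const_mul])

theorem l2Form_apply (φ ψ : 𝓢(V3, ℝ)) : l2Form φ ψ = ∫ x, φ x * ψ x := rfl

theorem integrable_schwartz_mul (φ ψ : 𝓢(V3, ℝ)) : Integrable fun x => φ x * ψ x :=
  (SchwartzMap.pairing (ContinuousLinearMap.mul ℝ ℝ) φ ψ).integrable

theorem l2Form_comm (φ ψ : 𝓢(V3, ℝ)) : l2Form φ ψ = l2Form ψ φ := by
  simp only [l2Form_apply, mul_comm]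

theorem l2Form_self_nonneg (φ : 𝓢(V3, ℝ)) : 0 ≤ l2Form φ φ :=
  integral_nonneg fun x => mul_self_nonneg (φ x)

theorem l2Form_partial_right (j : Fin 3) (φ ψ : 𝓢(V3, ℝ)) :
    l2Form φ (schwartzPartial j ψ) = -l2Form (schwartzPartial j φ) ψ :=
  SchwartzMap.integral_mul_lineDerivOp_right_eq_neg_left φ ψ _

/-- The Laplacian on scalar Schwartz functions. -/
def schwartzLaplacian : 𝓢(V3, ℝ) →L[ℝ] 𝓢(V3, ℝ) :=
  ∑ j, (schwartzPartial j).comp (schwartzPartial j)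

theorem schwartzLaplacian_eq (φ : 𝓢(V3, ℝ)) :
    schwartzLaplacian φ = ∑ j, schwartzPartial j (schwartzPartial j φ) := by
  simp [schwartzLaplacian]

/-- The Helmholtz operator `1 - α² Δ` on scalar Schwartz functions. -/
def helmholtz (α : ℝ) : 𝓢(V3, ℝ) →L[ℝ] 𝓢(V3, ℝ) :=
  ContinuousLinearMap.id ℝ _ - α ^ 2 • schwartzLaplacian

variable (α : ℝ)

theorem helmholtz_eq (φ : 𝓢(V3, ℝ)) :
    helmholtz α φ = φ - α ^ 2 • ∑ j, schwartzPartial j (schwartzPartial j φ) := by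
  simp [helmholtz, schwartzLaplacian_eq]

theorem l2Form_helmholtz (φ ψ : 𝓢(V3, ℝ)) :
    l2Form φ (helmholtz α ψ)
      = l2Form φ ψ + α ^ 2 * ∑ j, l2Form (schwartzPartial j φ) (schwartzPartial j ψ) := by
  simp [helmholtz_eq, l2Form_partial_right, ← sub_eq_add_neg]

theorem l2Form_helmholtz_comm (φ ψ : 𝓢(V3, ℝ)) :
    l2Form φ (helmholtz α ψ) = l2Form (helmholtz α φ) ψ := by
  rw [l2Form_comm (helmholtz α φ), l2Form_helmholtz, l2Form_helmholtz, l2Form_comm φ]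
  simp only [l2Form_comm (schwartzPartial _ φ)]

theorem l2Form_helmholtz_self_nonneg (φ : 𝓢(V3, ℝ)) : 0 ≤ l2Form φ (helmholtz α φ) := by
  rw [l2Form_helmholtz]
  have := l2Form_self_nonneg
  exact add_nonneg (this _) (mul_nonneg (sq_nonneg _) (Finset.sum_nonneg fun _ _ => this _))

theorem schwartzPartial_helmholtz (j : Fin 3) (φ : 𝓢(V3, ℝ)) :
    schwartzPartial j (helmholtz α φ) = helmholtz α (schwartzPartial j φ) := by
  simp only [helmholtz_eq, map_sub, map_smul, map_sum]
  simp only [schwartzPartial_comm j]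

theorem l2Form_laplacian_helmholtz_nonpos (φ : 𝓢(V3, ℝ)) :
    l2Form (schwartzLaplacian φ) (helmholtz α φ) ≤ 0 := by
  simp only [schwartzLaplacian_eq, map_sum, LinearMap.sum_apply]
  refine Finset.sum_nonpos fun j _ => ?_
  rw [l2Form_comm, l2Form_partial_right, schwartzPartial_helmholtz, l2Form_comm]
  exact neg_nonpos.2 (l2Form_helmholtz_self_nonneg α _)

/-- The squared `H¹_α` norm of a vector field with Schwartz components. -/
def energy (U : Fin 3 → 𝓢(V3, ℝ)) : ℝ := ∑ i, l2Form (U i) (helmholtz α (U i))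

theorem energy_nonneg (U : Fin 3 → 𝓢(V3, ℝ)) : 0 ≤ energy α U :=
  Finset.sum_nonneg fun _ _ => l2Form_helmholtz_self_nonneg α _

theorem energy_sub_energy (U W : Fin 3 → 𝓢(V3, ℝ)) :
    energy α U - energy α W = ∑ i, l2Form (U i - W i) (helmholtz α (U i) + helmholtz α (W i)) := by
  rw [energy, energy, ← Finset.sum_sub_distrib]
  refine Finset.sum_congr rfl fun i _ => ?_
  have := l2Form_helmholtz_comm α (U i) (W i)
  rw [l2Form_comm] at this
  rw [l2Form_comm (helmholtz α (U i))] at this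
  simp only [map_add, map_sub, LinearMap.sub_apply]
  rw [l2Form_comm (U i) (helmholtz α (W i)), this]
  ring

theorem two_mul_sum_l2Form_le {β : ℝ} (hβ : 0 < β) (F U : Fin 3 → 𝓢(V3, ℝ)) :
    2 * ∑ i, l2Form (F i) (helmholtz α (U i)) ≤ β * energy α U + energy α F / β := by
  have h := energy_nonneg α fun i => β • U i - F i
  have hexp : energy α (fun i => β • U i - F i)
      = β ^ 2 * energy α U + energy α F - 2 * β * ∑ i, l2Form (F i) (helmholtz α (U i)) := by
    simp only [energy, Finset.mul_sum, ← Finset.sum_add_distrib, ← Finset.sum_sub_distrib]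
    refine Finset.sum_congr rfl fun i _ => ?_
    have h2 : l2Form (U i) (helmholtz α (F i)) = l2Form (F i) (helmholtz α (U i)) := by
      rw [l2Form_helmholtz_comm, l2Form_comm]
    simp only [map_sub, map_smul, LinearMap.sub_apply, LinearMap.smul_apply, smul_eq_mul, h2]
    ring
  rw [hexp] at h
  rw [← sub_nonneg]
  have : β * energy α U + energy α F / β - 2 * ∑ i, l2Form (F i) (helmholtz α (U i))
      = (β ^ 2 * energy α U + energy α F
        - 2 * β * ∑ i, l2Form (F i) (helmholtz α (U i))) / β := by
    field_simp
  rw [this]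
  positivity

theorem sum_l2Form_gradient_helmholtz {U : Fin 3 → 𝓢(V3, ℝ)}
    (hdiv : ∑ i, schwartzPartial i (U i) = 0) (P : 𝓢(V3, ℝ)) :
    ∑ i, l2Form (schwartzPartial i P) (helmholtz α (U i)) = 0 := by
  have h (i : Fin 3) : l2Form (schwartzPartial i P) (helmholtz α (U i))
      = -l2Form P (helmholtz α (schwartzPartial i (U i))) := by
    rw [← schwartzPartial_helmholtz, l2Form_partial_right, neg_neg]
  simp only [h, Finset.sum_neg_distrib, ← map_sum, hdiv, map_zero, neg_zero]

theorem sum_integral_advection {U : Fin 3 → 𝓢(V3, ℝ)}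
    (hdiv : ∑ i, schwartzPartial i (U i) = 0) (φ : 𝓢(V3, ℝ)) :
    ∑ j, ∫ x, U j x * schwartzPartial j φ x * φ x = 0 := by
  have h (j : Fin 3) : 2 * ∫ x, U j x * schwartzPartial j φ x * φ x
      = -l2Form (schwartzPartial j (U j))
          (SchwartzMap.pairing (ContinuousLinearMap.mul ℝ ℝ) φ φ) := by
    rw [← l2Form_partial_right, l2Form_apply, ← integral_const_mul]
    refine integral_congr_ae (Eventually.of_forall fun x => ?_)
    have : schwartzPartial j (SchwartzMap.pairing (ContinuousLinearMap.mul ℝ ℝ) φ φ) x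
        = 2 * φ x * schwartzPartial j φ x := by
      rw [schwartzPartial_apply, schwartzPartial_apply, SchwartzMap.pairing_apply]
      simp only [ContinuousLinearMap.mul_apply']
      rw [fderiv_fun_mul φ.differentiableAt φ.differentiableAt]
      simp only [_root_.add_apply, _root_.smul_apply, smul_eq_mul]
      ring
    simp only [this]
    ring
  have hsum : 2 * ∑ j, ∫ x, U j x * schwartzPartial j φ x * φ x = 0 := by
    rw [Finset.mul_sum, Finset.sum_congr rfl fun j _ => h j, Finset.sum_neg_distrib,
      ← LinearMap.sum_apply, ← map_sum, hdiv]
    simp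
  linarith

theorem sum_l2Form_helmholtz_advection {U N : Fin 3 → 𝓢(V3, ℝ)}
    (hdiv : ∑ i, schwartzPartial i (U i) = 0)
    (hN : ∀ i x, helmholtz α (N i) x = ∑ j, U j x * schwartzPartial j (U i) x) :
    ∑ i, l2Form (N i) (helmholtz α (U i)) = 0 := by
  refine Finset.sum_eq_zero fun i _ => ?_
  rw [l2Form_helmholtz_comm, l2Form_apply, ← sum_integral_advection hdiv (U i),
    ← integral_finsetSum]
  · simp only [hN, Finset.sum_mul]
  · intro j _
    exact integrable_schwartz_mul
      (SchwartzMap.pairing (ContinuousLinearMap.mul ℝ ℝ) (U j) (schwartzPartial j (U i))) (U i)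

theorem energy_dissipation_le {β ν : ℝ} (hβ : 0 < β) (hν : 0 ≤ ν)
    {U N F : Fin 3 → 𝓢(V3, ℝ)} (P : 𝓢(V3, ℝ))
    (hdiv : ∑ i, schwartzPartial i (U i) = 0)
    (hN : ∀ i x, helmholtz α (N i) x = ∑ j, U j x * schwartzPartial j (U i) x) :
    2 * ∑ i, l2Form (F i - β • U i - N i + ν • schwartzLaplacian (U i) - schwartzPartial i P)
        (helmholtz α (U i))
      ≤ -β * energy α U + energy α F / β := by
  simp only [map_sub, map_add, map_smul, LinearMap.sub_apply, LinearMap.add_apply,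
    LinearMap.smul_apply, smul_eq_mul, Finset.sum_sub_distrib, Finset.sum_add_distrib,
    sum_l2Form_gradient_helmholtz α hdiv, sum_l2Form_helmholtz_advection α hdiv hN,
    ← Finset.mul_sum]
  have h1 := two_mul_sum_l2Form_le α hβ F U
  have h2 : ν * ∑ i, l2Form (schwartzLaplacian (U i)) (helmholtz α (U i)) ≤ 0 :=
    mul_nonpos_of_nonneg_of_nonpos hν
      (Finset.sum_nonpos fun i _ => l2Form_laplacian_helmholtz_nonpos α (U i))
  rw [← energy]
  linarith

end EnergyForm

section VectorFields

variable {g : V3 → Fin 3 → ℝ} {Φ : Fin 3 → 𝓢(V3, ℝ)}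

theorem pd_eq_schwartzPartial (h : ∀ x i, g x i = Φ i x) (j : Fin 3) (x : V3) (i : Fin 3) :
    pd j g x i = schwartzPartial j (Φ i) x := by
  have hg : g = fun x i => Φ i x := funext fun x => funext fun i => h x i
  rw [pd, hg, fderiv_pi fun i => (Φ i).differentiableAt]
  rfl

theorem pd_pd_eq_schwartzPartial (h : ∀ x i, g x i = Φ i x) (j : Fin 3) (x : V3) (i : Fin 3) :
    pd j (pd j g) x i = schwartzPartial j (schwartzPartial j (Φ i)) x :=
  pd_eq_schwartzPartial (pd_eq_schwartzPartial h j) j x i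

theorem L2sq_add_H1sq_eq_energy (α : ℝ) (h : ∀ x i, g x i = Φ i x) :
    L2sq g + α ^ 2 * H1sq g = energy α Φ := by
  have h0 : L2sq g = ∑ i, l2Form (Φ i) (Φ i) := by
    simp only [L2sq, h, l2Form_apply, sq]
    exact integral_finsetSum _ fun i _ => integrable_schwartz_mul _ _
  have h1 : H1sq g = ∑ i, ∑ j, l2Form (schwartzPartial j (Φ i)) (schwartzPartial j (Φ i)) := by
    simp only [H1sq, pd_eq_schwartzPartial h, l2Form_apply, sq]
    rw [integral_finsetSum _ fun i _ => integrable_finsetSum _ fun j _ =>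
      integrable_schwartz_mul _ _]
    exact Finset.sum_congr rfl fun i _ =>
      integral_finsetSum _ fun j _ => integrable_schwartz_mul _ _
  simp only [h0, h1, energy, l2Form_helmholtz, Finset.mul_sum, Finset.sum_add_distrib]

theorem sum_schwartzPartial_eq_zero (h : ∀ x i, g x i = Φ i x)
    (hdiv : ∀ x, ∑ j, pd j g x j = 0) : ∑ i, schwartzPartial i (Φ i) = 0 := by
  ext x
  simpa [pd_eq_schwartzPartial h] using hdiv x

theorem IsSchwartz.exists_components (hg : IsSchwartz g) :
    ∃ Φ : Fin 3 → 𝓢(V3, ℝ), ∀ x i, g x i = Φ i x :=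
  ⟨fun i => SchwartzMap.postcompCLM (𝕜 := ℝ)
    (ContinuousLinearMap.proj (R := ℝ) (φ := fun _ : Fin 3 => ℝ) i) ⟨g, hg.1, hg.2⟩,
    fun _ _ => rfl⟩

end VectorFields

section Families

/-- Smoothness up to time zero of a time-dependent scalar Schwartz function. -/
def IsSmoothFamily (Φ : ℝ → 𝓢(V3, ℝ)) : Prop :=
  ContDiffOn ℝ (⊤ : ℕ∞) (fun q : ℝ × V3 => Φ q.1 q.2) (Ici 0 ×ˢ univ)

/-- All Schwartz seminorms are bounded on bounded time intervals. -/
def IsLocBddFamily (Φ : ℝ → 𝓢(V3, ℝ)) : Prop :=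
  ∀ T > 0, IsVonNBounded ℝ (Φ '' Icc 0 T)

theorem SchwartzLocBdd.exists_family {F : Type*} [NormedAddCommGroup F] [NormedSpace ℝ F]
    {g : ℝ → V3 → F} (hg : SchwartzLocBdd g) :
    ∃ G : ℝ → 𝓢(V3, F), (∀ t ≥ 0, ⇑(G t) = g t) ∧ ∀ T > 0, IsVonNBounded ℝ (G '' Icc 0 T) := by
  have hs (t : ℝ) : IsSchwartz (g (max t 0)) := by
    refine ⟨contDiffOn_univ.1 (hg.1.comp (g := fun q : ℝ × V3 => g q.1 q.2)
      (f := fun x => (max t 0, x)) (by fun_prop) fun x _ => ⟨le_max_right t 0, mem_univ _⟩),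
      fun k n => ?_⟩
    obtain ⟨C, hC⟩ := hg.2 (max t 0 + 1) (by positivity) k n
    exact ⟨C, hC _ ⟨le_max_right _ _, by linarith⟩⟩
  refine ⟨fun t => ⟨g (max t 0), (hs t).1, (hs t).2⟩, fun t ht => ?_, fun T hT => ?_⟩
  · change g (max t 0) = g t
    rw [max_eq_left ht]
  · rw [(schwartz_withSeminorms ℝ V3 F).image_isVonNBounded_iff_seminorm_bounded]
    rintro ⟨k, n⟩
    obtain ⟨C, hC⟩ := hg.2 T hT k n
    refine ⟨max C 0 + 1, by positivity, fun t ht => ?_⟩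
    refine (SchwartzMap.seminorm_le_bound ℝ k n _ (le_max_right C 0) fun x => ?_).trans_lt
      (lt_add_one _)
    refine le_trans (le_of_eq ?_) ((hC t ht x).trans (le_max_left _ _))
    change ‖x‖ ^ k * ‖iteratedFDeriv ℝ n (g (max t 0)) x‖ = _
    rw [max_eq_left ht.1]

theorem SchwartzLocBdd.exists_scalar_family {g : ℝ → V3 → ℝ} (hg : SchwartzLocBdd g) :
    ∃ Φ : ℝ → 𝓢(V3, ℝ), (∀ t ≥ 0, ∀ x, g t x = Φ t x) ∧ IsLocBddFamily Φ := by
  obtain ⟨G, hG, hb⟩ := hg.exists_family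
  exact ⟨G, fun t ht x => by rw [hG t ht], hb⟩

variable {Φ Ψ : ℝ → 𝓢(V3, ℝ)}

theorem IsLocBddFamily.clm_comp (hΦ : IsLocBddFamily Φ) (L : 𝓢(V3, ℝ) →L[ℝ] 𝓢(V3, ℝ)) :
    IsLocBddFamily fun t => L (Φ t) := fun T hT => by
  simpa only [image_image] using (hΦ T hT).image L

theorem IsLocBddFamily.add (hΦ : IsLocBddFamily Φ) (hΨ : IsLocBddFamily Ψ) :
    IsLocBddFamily fun t => Φ t + Ψ t := fun T hT =>
  ((hΦ T hT).add (hΨ T hT)).subset <| by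
    rintro _ ⟨t, ht, rfl⟩
    exact Set.add_mem_add (mem_image_of_mem _ ht) (mem_image_of_mem _ ht)

theorem IsLocBddFamily.sub (hΦ : IsLocBddFamily Φ) (hΨ : IsLocBddFamily Ψ) :
    IsLocBddFamily fun t => Φ t - Ψ t := fun T hT =>
  ((hΦ T hT).sub (hΨ T hT)).subset <| by
    rintro _ ⟨t, ht, rfl⟩
    exact Set.sub_mem_sub (mem_image_of_mem _ ht) (mem_image_of_mem _ ht)

theorem IsLocBddFamily.const_smul (hΦ : IsLocBddFamily Φ) (c : ℝ) :
    IsLocBddFamily fun t => c • Φ t := by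
  simpa using hΦ.clm_comp (c • ContinuousLinearMap.id ℝ 𝓢(V3, ℝ))

theorem isLocBddFamily_const (φ : 𝓢(V3, ℝ)) : IsLocBddFamily fun _ => φ := fun _ _ =>
  (isVonNBounded_singleton φ).subset (image_subset_iff.2 fun _ _ => mem_singleton _)

theorem IsLocBddFamily.exists_decay (hΦ : IsLocBddFamily Φ) {T : ℝ} (hT : 0 < T) (k : ℕ) :
    ∃ C, ∀ t ∈ Icc 0 T, ∀ x, (1 + ‖x‖) ^ k * |Φ t x| ≤ C := by
  obtain ⟨r, -, hr⟩ := ((schwartz_withSeminorms ℝ V3 ℝ).image_isVonNBounded_iff_finset_seminorm_bounded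
      Φ).1 (hΦ T hT) (Finset.Iic (k, 0))
  refine ⟨2 ^ k * r, fun t ht x => ?_⟩
  have h := SchwartzMap.one_add_le_sup_seminorm_apply (𝕜 := ℝ) (m := (k, 0)) le_rfl le_rfl (Φ t) x
  rw [norm_iteratedFDeriv_zero, Real.norm_eq_abs] at h
  exact h.trans (mul_le_mul_of_nonneg_left (hr t ht).le (by positivity))

theorem IsSmoothFamily.schwartzPartial (hΦ : IsSmoothFamily Φ) (j : Fin 3) :
    IsSmoothFamily fun t => schwartzPartial j (Φ t) := by
  have hS : UniqueDiffOn ℝ (Ici (0 : ℝ) ×ˢ (univ : Set V3)) :=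
    (uniqueDiffOn_Ici 0).prod uniqueDiffOn_univ
  have h := (hΦ.fderivWithin hS (m := (⊤ : ℕ∞)) (by simp)).clm_apply
    (contDiffOn_const (c := ((0 : ℝ), (Pi.single j 1 : V3))))
  refine h.congr fun q hq => ?_
  have hd := ((hΦ.differentiableOn (by simp)) q hq).hasFDerivWithinAt
  have hc : HasFDerivAt (fun x : V3 => (q.1, x)) (ContinuousLinearMap.inr ℝ ℝ V3) q.2 :=
    hasFDerivAt_prodMk_right _ _
  have := hd.comp_hasFDerivAt (f := fun x : V3 => (q.1, x)) q.2 hc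
    (Eventually.of_forall fun x => ⟨hq.1, mem_univ _⟩)
  change fderiv ℝ (Φ q.1) q.2 (Pi.single j 1) = _
  rw [HasFDerivAt.fderiv (f := Φ q.1) this]
  simp

theorem IsSmoothFamily.differentiableOn_time (hΦ : IsSmoothFamily Φ) (x : V3) :
    DifferentiableOn ℝ (fun s => Φ s x) (Ici 0) :=
  (hΦ.differentiableOn (by simp)).comp (f := fun s : ℝ => (s, x)) (by fun_prop)
    fun _ hs => ⟨hs, mem_univ _⟩

theorem IsSmoothFamily.continuousOn_helmholtz (hΦ : IsSmoothFamily Φ) (α : ℝ) (x : V3) :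
    ContinuousOn (fun s => helmholtz α (Φ s) x) (Ici 0) := by
  have h : (fun s => helmholtz α (Φ s) x) = fun s => Φ s x
      - α ^ 2 * ∑ j, _root_.schwartzPartial j (_root_.schwartzPartial j (Φ s)) x := by
    funext s
    simp [helmholtz_eq]
  rw [h]
  have hj (j : Fin 3) :=
    (((hΦ.schwartzPartial j).schwartzPartial j).differentiableOn_time x).continuousOn
  exact (hΦ.differentiableOn_time x).continuousOn.sub
    (continuousOn_const.mul (continuousOn_finsetSum _ fun j _ => hj j))

theorem SchwartzLocBdd.exists_component_families {g : ℝ → V3 → Fin 3 → ℝ}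
    (hg : SchwartzLocBdd g) :
    ∃ Φ : Fin 3 → ℝ → 𝓢(V3, ℝ), (∀ t ≥ 0, ∀ x i, g t x i = Φ i t x) ∧
      ∀ i, IsSmoothFamily (Φ i) ∧ IsLocBddFamily (Φ i) := by
  obtain ⟨G, hG, hb⟩ := hg.exists_family
  refine ⟨fun i t => SchwartzMap.postcompCLM (𝕜 := ℝ)
    (ContinuousLinearMap.proj (R := ℝ) (φ := fun _ : Fin 3 => ℝ) i) (G t),
    fun t ht x i => ?_, fun i => ⟨?_, fun T hT => ?_⟩⟩
  · simp [hG t ht]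
  · refine ((contDiffOn_pi.1 hg.1) i).congr fun q hq => ?_
    simp [hG q.1 hq.1]
  · simpa only [image_image] using (hb T hT).image (SchwartzMap.postcompCLM (𝕜 := ℝ)
      (ContinuousLinearMap.proj (R := ℝ) (φ := fun _ : Fin 3 => ℝ) i))

/-- If `U` has time derivative `V`, the `H¹_α` energy is differentiable in time. -/
theorem hasDerivWithinAt_energy (α : ℝ) {U V : Fin 3 → ℝ → 𝓢(V3, ℝ)}
    (hU : ∀ i, IsSmoothFamily (U i)) (hUb : ∀ i, IsLocBddFamily (U i))
    (hVb : ∀ i, IsLocBddFamily (V i))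
    (hV : ∀ t ≥ 0, ∀ i x, derivWithin (fun s => U i s x) (Ici 0) t = V i t x)
    {t : ℝ} (ht : 0 ≤ t) :
    HasDerivWithinAt (fun s => energy α fun i => U i s)
      (2 * ∑ i, l2Form (V i t) (helmholtz α (U i t))) (Ici 0) t := by
  have hderiv (i : Fin 3) (s : ℝ) (hs : 0 ≤ s) (x : V3) :
      HasDerivWithinAt (fun s => U i s x) (V i s x) (Ici 0) s := by
    rw [← hV s hs i x]
    exact ((hU i).differentiableOn_time x s hs).hasDerivWithinAt
  rw [hasDerivWithinAt_iff_tendsto_slope, Finset.mul_sum]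
  have hslope (s : ℝ) : slope (fun s => energy α fun i => U i s) t s
      = ∑ i, ∫ x, slope (fun s => U i s x) t s
          * (helmholtz α (U i s) x + helmholtz α (U i t) x) := by
    rw [slope_def_module, energy_sub_energy, smul_eq_mul, Finset.mul_sum]
    refine Finset.sum_congr rfl fun i _ => ?_
    rw [l2Form_apply, ← integral_const_mul]
    simp [slope_def_module, mul_assoc]
  simp only [funext hslope]
  refine tendsto_finsetSum _ fun i _ => ?_
  obtain ⟨C, hC⟩ := (hVb i).exists_decay (T := t + 1) (by linarith) 0
  obtain ⟨K, hK⟩ := ((hUb i).clm_comp (helmholtz α)).exists_decay (T := t + 1) (by linarith) 4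
  have htmem : t ∈ Icc 0 (t + 1) := ⟨ht, by linarith⟩
  have hnear : ∀ᶠ s in 𝓝[Ici 0 \ {t}] t, s ∈ Icc 0 (t + 1) := by
    filter_upwards [self_mem_nhdsWithin, nhdsWithin_le_nhds (Iio_mem_nhds (lt_add_one t))]
      with s hs hs' using ⟨hs.1, hs'.le⟩
  have hw (s : ℝ) (hs : s ∈ Icc 0 (t + 1)) (x : V3) :
      |helmholtz α (U i s) x| ≤ K * (1 + ‖x‖) ^ (-(4 : ℝ)) := by
    have : (0 : ℝ) < 1 + ‖x‖ := by positivity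
    rw [Real.rpow_neg this.le, ← div_eq_mul_inv, le_div_iff₀ (by positivity), mul_comm]
    exact_mod_cast hK s hs x
  have hlip (s : ℝ) (hs : s ∈ Icc 0 (t + 1)) (x : V3) :
      |slope (fun s => U i s x) t s| ≤ C := by
    have hC0 : 0 ≤ C := (abs_nonneg _).trans (by simpa using hC t htmem x)
    have h := Convex.norm_image_sub_le_of_norm_hasDerivWithin_le (f := fun s => U i s x)
      (fun r hr => (hderiv i r hr.1 x).mono Icc_subset_Ici_self)
      (fun r hr => by simpa using hC r hr x) (convex_Icc 0 (t + 1)) htmem hs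
    rw [slope_def_field, abs_div]
    exact div_le_of_le_mul₀ (abs_nonneg _) hC0 h
  have hlim : 2 * l2Form (V i t) (helmholtz α (U i t))
      = ∫ x, V i t x * (helmholtz α (U i t) x + helmholtz α (U i t) x) := by
    rw [l2Form_apply, ← integral_const_mul]
    congr 1
    funext x
    ring
  rw [hlim]
  refine tendsto_integral_filter_of_dominated_convergence
    (fun x => C * (2 * (K * (1 + ‖x‖) ^ (-(4 : ℝ))))) ?_ ?_ ?_ ?_
  · refine Eventually.of_forall fun s => Continuous.aestronglyMeasurable ?_
    simp only [slope_def_field]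
    have := (U i s).continuous
    have := (U i t).continuous
    have := (helmholtz α (U i s)).continuous
    have := (helmholtz α (U i t)).continuous
    fun_prop
  · filter_upwards [hnear] with s hs
    refine Eventually.of_forall fun x => ?_
    rw [norm_mul, Real.norm_eq_abs, Real.norm_eq_abs]
    have h1 := hlip s hs x
    refine mul_le_mul h1 ((abs_add_le _ _).trans ?_) (abs_nonneg _) ((abs_nonneg _).trans h1)
    linarith [hw s hs x, hw t htmem x]
  · refine (((integrable_one_add_norm ?_).const_mul K).const_mul 2).const_mul C
    simp
    norm_num
  · refine Eventually.of_forall fun x => Tendsto.mul ?_ (Tendsto.add ?_ tendsto_const_nhds)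
    · exact hasDerivWithinAt_iff_tendsto_slope.1 (hderiv i t ht x)
    · exact ((hU i).continuousOn_helmholtz α x t ht).mono_left
        (nhdsWithin_mono _ sdiff_subset)

end Families

/-- Gronwall's inequality on `[0, ∞)` for `E' ≤ -β E + c`. -/
theorem le_exp_decay_of_hasDerivWithinAt_le {E E' : ℝ → ℝ} {β c : ℝ} (hβ : 0 < β) (hc : 0 ≤ c)
    (hE : ∀ t ≥ 0, HasDerivWithinAt E (E' t) (Ici 0) t) (hle : ∀ t ≥ 0, E' t ≤ -β * E t + c)
    {t : ℝ} (ht : 0 ≤ t) : E t ≤ E 0 * Real.exp (-β * t) + c / β := by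
  have hG (s : ℝ) (hs : 0 ≤ s) : HasDerivWithinAt (fun s => Real.exp (β * s) * (E s - c / β))
      (Real.exp (β * s) * β * (E s - c / β) + Real.exp (β * s) * E' s) (Ici 0) s := by
    have h1 : HasDerivAt (fun s => Real.exp (β * s)) (Real.exp (β * s) * β) s := by
      simpa using ((hasDerivAt_id s).const_mul β).exp
    exact h1.hasDerivWithinAt.mul ((hE s hs).sub_const _)
  have hanti : AntitoneOn (fun s => Real.exp (β * s) * (E s - c / β)) (Ici 0) := by
    refine antitoneOn_of_hasDerivWithinAt_nonpos (convex_Ici 0)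
      (fun s hs => (hG s hs).continuousWithinAt)
      (fun s hs => (hG s (interior_subset hs)).mono interior_subset) fun s hs => ?_
    have h := hle s (interior_subset hs)
    have : Real.exp (β * s) * β * (E s - c / β) + Real.exp (β * s) * E' s
        = Real.exp (β * s) * (E' s - (-β * E s + c)) := by
      field_simp
      ring
    rw [this]
    exact mul_nonpos_of_nonneg_of_nonpos (Real.exp_pos _).le (sub_nonpos.2 h)
  have h := hanti (mem_Ici.2 le_rfl) ht ht
  simp only [mul_zero, Real.exp_zero, one_mul] at h
  have h2 := mul_le_mul_of_nonneg_left h (Real.exp_pos (-β * t)).le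
  rw [← mul_assoc, ← Real.exp_add, neg_mul, neg_add_cancel, Real.exp_zero, one_mul] at h2
  have h3 : 0 ≤ Real.exp (-(β * t)) * (c / β) := by positivity
  rw [neg_mul]
  linarith

/-- Exponential-in-time control of the `H¹_α` norm of classical solutions. -/
theorem time_control (α β ν : ℝ) (hα : 0 < α) (hβ : 0 < β) (hν : 0 < ν)
    (u₀ f : V3 → Fin 3 → ℝ) (hf : IsForce f)
    (sol : ClassicalSolution α β ν u₀ f) (t : ℝ) (ht : 0 ≤ t) :
    L2sq (sol.u t) + α^2 * H1sq (sol.u t)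
      ≤ (L2sq u₀ + α^2 * H1sq u₀) * Real.exp (-β * t)
        + 4 / β^2 * (L2sq f + α^2 * H1sq f) := by
  obtain ⟨U, hU, hUreg⟩ := sol.reg_u.exists_component_families
  obtain ⟨N, hN, hNreg⟩ := sol.reg_N.exists_component_families
  obtain ⟨P, hP, hPb⟩ := sol.reg_p.exists_scalar_family
  obtain ⟨F, hF⟩ := hf.1.exists_components
  have hdiv (s : ℝ) (hs : 0 ≤ s) : ∑ i, schwartzPartial i (U i s) = 0 :=
    sum_schwartzPartial_eq_zero (hU s hs) (sol.divFree s hs)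
  have hfilter (s : ℝ) (hs : 0 ≤ s) (i : Fin 3) (x : V3) :
      helmholtz α (N i s) x = ∑ j, U j s x * schwartzPartial j (U i s) x := by
    have h := sol.filter s hs x i
    simp only [pd_pd_eq_schwartzPartial (Φ := fun i => N i s) (hN s hs),
      pd_eq_schwartzPartial (Φ := fun i => U i s) (hU s hs), hN s hs, hU s hs] at h
    rw [← h, helmholtz_eq]
    simp
    ring
  let V : Fin 3 → ℝ → 𝓢(V3, ℝ) := fun i s =>
    F i - β • U i s - N i s + ν • schwartzLaplacian (U i s) - schwartzPartial i (P s)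
  have hVb (i : Fin 3) : IsLocBddFamily (V i) :=
    ((((isLocBddFamily_const (F i)).sub ((hUreg i).2.const_smul β)).sub (hNreg i).2).add
      (((hUreg i).2.clm_comp schwartzLaplacian).const_smul ν)).sub
      (hPb.clm_comp (schwartzPartial i))
  have hV (s : ℝ) (hs : s ≥ 0) (i : Fin 3) (x : V3) :
      derivWithin (fun r => U i r x) (Ici 0) s = V i s x := by
    have h := sol.momentum s hs x i
    have hpS : pdS i (sol.p s) x = schwartzPartial i (P s) x := by
      rw [pdS, funext (hP s hs)]
      rfl
    have hu : derivWithin (fun r => sol.u r x i) (Ici 0) s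
        = derivWithin (fun r => U i r x) (Ici 0) s :=
      derivWithin_congr (fun r hr => hU r hr x i) (hU s hs x i)
    rw [hpS, hu, hN s hs, hU s hs, hF] at h
    simp only [pd_pd_eq_schwartzPartial (Φ := fun i => U i s) (hU s hs)] at h
    simp only [V, schwartzLaplacian_eq]
    simp
    linarith
  have hE := le_exp_decay_of_hasDerivWithinAt_le (c := energy α F / β) hβ
    (div_nonneg (energy_nonneg α F) hβ.le)
    (fun s hs => hasDerivWithinAt_energy α (fun i => (hUreg i).1) (fun i => (hUreg i).2) hVb hV hs)
    (fun s hs => energy_dissipation_le α hβ hν.le (P s) (hdiv s hs) (hfilter s hs)) ht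
  rw [L2sq_add_H1sq_eq_energy α (hU t ht), L2sq_add_H1sq_eq_energy α hF,
    ← show sol.u 0 = u₀ from funext sol.init, L2sq_add_H1sq_eq_energy α (hU 0 le_rfl)]
  refine hE.trans (add_le_add_right ?_ _)
  rw [div_div, ← sq, div_eq_inv_mul, ← one_div]
  have := energy_nonneg α F
  gcongr
  norm_num

end
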